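/- arXiv:2511.01622 — 2 statements merged into one kernel-verified Lean document; each statement's English description precedes it below -/
import Mathlib

section
/- Let X be a Noetherian scheme whose category of coherent sheaves coh(X) is an Artinian abelian category. Then X is an affine Artinian scheme. -/
open CategoryTheory CategoryTheory.Limits AlgebraicGeometry

/-- A sheaf of modules over a (locally Noetherian) scheme is coherent when it is
quasi-coherent and of finite type. -/
def AlgebraicGeometry.Scheme.Modules.IsCoherent {X : Scheme} (M : X.Modules) : Prop :=
  M.IsQuasicoherent ∧ M.IsFiniteType

universe u

theorem CohArt.ideal_aux {A : Type*} [CommRing A] [IsNoetherianRing A]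
    (h : ∀ q : Ideal A, q.IsPrime → ∃ n : ℕ, q ^ n = q ^ (n + 1)) : IsArtinianRing A := by
  rw [isArtinianRing_iff_krullDimLE_zero, Ring.krullDimLE_zero_iff]
  intro p hp
  obtain ⟨m, hm, hpm⟩ := Ideal.exists_le_maximal p hp.ne_top
  suffices m ≤ p by rwa [le_antisymm hpm this]
  obtain ⟨n, hn⟩ := h m hm.isPrime
  obtain ⟨r, hr, hr'⟩ := Submodule.exists_sub_one_mem_and_smul_eq_zero_of_fg_of_le_smul m (m ^ n)
    (IsNoetherian.noetherian _) (by rw [smul_eq_mul, ← pow_succ', ← hn])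
  intro x hx
  have h0 : r * x ^ n = 0 := hr' _ (Ideal.pow_mem_pow hx n)
  have : r * x ^ n ∈ p := by rw [h0]; exact p.zero_mem
  rcases hp.mem_or_mem this with h1 | h1
  · exact absurd ((Ideal.eq_top_iff_one _).2 (by simpa using m.sub_mem (hpm h1) hr)) hm.ne_top
  · exact hp.mem_of_pow_mem _ h1

theorem CohArt.final (X : Scheme.{u}) [AlgebraicGeometry.IsNoetherian X]
    (h : ∀ I : X.IdealSheafData, ∃ n : ℕ, I ^ n = I ^ (n + 1)) :
    IsAffine X ∧ IsArtinianRing Γ(X, ⊤) := by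
  have : IsLocallyArtinian X := by
    refine ⟨fun ⟨U, hU⟩ ↦ ?_⟩
    have hU : IsAffineOpen U := hU
    have : IsNoetherianRing Γ(X, U) := IsLocallyNoetherian.component_noetherian ⟨U, hU⟩
    refine CohArt.ideal_aux fun q hq ↦ ?_
    let x : Spec Γ(X, U) := ⟨q, hq⟩
    let Z : TopologicalSpace.Closeds X := .closure {hU.fromSpec x}
    obtain ⟨n, hn⟩ := h (.vanishingIdeal Z)
    have hq' : (Scheme.IdealSheafData.vanishingIdeal Z).ideal ⟨U, hU⟩ = q := by
      rw [Scheme.IdealSheafData.vanishingIdeal_ideal]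
      have : hU.fromSpec ⁻¹' (Z : Set X) = closure {x} := by
        rw [hU.fromSpec.isOpenEmbedding.isInducing.closure_eq_preimage_closure_image]
        simp [Z]
      change PrimeSpectrum.vanishingIdeal (hU.fromSpec ⁻¹' (Z : Set X)) = q
      refine (congrArg (fun s : Set (PrimeSpectrum Γ(X, U)) ↦ PrimeSpectrum.vanishingIdeal s) this).trans ?_
      exact (PrimeSpectrum.vanishingIdeal_closure _).trans
        (PrimeSpectrum.vanishingIdeal_singleton _)
    refine ⟨n, ?_⟩
    have : (Scheme.IdealSheafData.vanishingIdeal Z).ideal ⟨U, hU⟩ ^ n =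
      (Scheme.IdealSheafData.vanishingIdeal Z).ideal ⟨U, hU⟩ ^ (n + 1) :=
      congrArg (fun K : X.IdealSheafData ↦ K.ideal ⟨U, hU⟩) hn
    rwa [hq'] at this
  have : IsArtinianScheme X := {}
  have : IsAffine X := inferInstance
  exact ⟨this, inferInstance⟩


theorem CohArt.pres_tilde {R : CommRingCat.{u}} [IsNoetherianRing R] (M : ModuleCat.{u} R)
    [Module.Finite R M] : ∃ P : (tilde M).Presentation, P.IsFinite := by
  obtain ⟨s, hs⟩ := Module.Finite.fg_top (R := R) (M := M)
  obtain ⟨t, ht⟩ : (LinearMap.ker (Finsupp.linearCombination R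
    ((↑) : ((s : Set M) : Type u) → M))).FG := IsNoetherian.noetherian _
  refine ⟨presentationTilde M s hs t ht, ⟨⟨?_⟩, ⟨?_⟩⟩⟩
  · exact s.finite_toSet
  · exact t.finite_toSet


noncomputable def CohArt.presIso {X : Scheme.{u}} {M N : X.Modules} (e : M ≅ N)
    (p : SheafOfModules.Presentation.{u, u, u} M) : SheafOfModules.Presentation.{u, u, u} N :=
  haveI : IsIso (C := SheafOfModules.{u} X.ringCatSheaf) e.hom :=
    ⟨e.inv, e.hom_inv_id, e.inv_hom_id⟩
  SheafOfModules.Presentation.ofIsIso.{u, u, u} e.hom p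

theorem CohArt.presIso_fin {X : Scheme.{u}} {M N : X.Modules} (e : M ≅ N)
    (p : SheafOfModules.Presentation.{u, u, u} M) (hp : p.IsFinite) :
    (CohArt.presIso e p).IsFinite :=
  ⟨⟨hp.1.1⟩, ⟨hp.2.1⟩⟩

noncomputable def CohArt.presOver {X : Scheme.{u}} (U : X.Opens) (N : X.Modules)
    (p : SheafOfModules.Presentation.{u, u, u} (N.restrict U.ι)) :
    SheafOfModules.Presentation.{u, u, u} (SheafOfModules.over.{u, u, u, u} N U) :=
  let E := TopologicalSpace.Opens.sheafOfModulesEquivOver.{u, u, u} U X.ringCatSheaf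
  let p' : SheafOfModules.Presentation.{u, u, u} (E.functor.obj (SheafOfModules.over N U)) :=
    CohArt.presIso ((Scheme.Modules.overFunctorEquiv U).app N).symm p
  let p2 := SheafOfModules.Presentation.map.{u, u, u, u} p' E.inverse
    (TopologicalSpace.Opens.sheafOfModulesEquivOverInverseUnit U X.ringCatSheaf).symm
  SheafOfModules.Presentation.ofIsIso.{u, u, u} (E.unitIso.app (SheafOfModules.over.{u, u, u, u} N U)).inv p2

theorem CohArt.fp_of_restrict {X : Scheme.{u}} [IsLocallyNoetherian X] (N : X.Modules)
    (h : ∀ (U : X.Opens) (hU : IsAffineOpen U),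
      ∃ P : ModuleCat.{u} Γ(X, U), Module.Finite Γ(X, U) P ∧
        Nonempty (N.restrict hU.fromSpec ≅ tilde P)) :
    SheafOfModules.IsFinitePresentation.{u, u, u} N := by
  have key : ∀ U : X.affineOpens, ∃ P : SheafOfModules.Presentation.{u, u, u}
      (SheafOfModules.over.{u, u, u, u} N U.1), P.IsFinite := by
    intro ⟨U, hU⟩
    have hU : IsAffineOpen U := hU
    obtain ⟨P, hP, ⟨e⟩⟩ := h U hU
    have : IsNoetherianRing Γ(X, U) := IsLocallyNoetherian.component_noetherian ⟨U, hU⟩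
    obtain ⟨p, hp⟩ := CohArt.pres_tilde P
    let p1 := CohArt.presIso e.symm p
    let e2 : (N.restrict hU.fromSpec).restrict hU.isoSpec.hom ≅ N.restrict U.ι :=
      ((Scheme.Modules.restrictFunctorComp _ _).app N).symm ≪≫
        (Scheme.Modules.restrictFunctorCongr (by simp)).app N
    let p2 := CohArt.presIso e2 (Scheme.Modules.presentationRestrict hU.isoSpec.hom p1)
    refine ⟨CohArt.presOver U N p2, ⟨⟨?_⟩, ⟨?_⟩⟩⟩
    · exact hp.1.1
    · exact hp.2.1
  choose P hP using key
  have hc : (Opens.grothendieckTopology X).CoversTop (fun U : X.affineOpens ↦ U.1) := by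
    rw [Opens.coversTop_iff]
    exact iSup_affineOpens_eq_top X
  let q := SheafOfModules.QuasicoherentData.mk.{u, u, u, u} (M := N) X.affineOpens
    (fun U ↦ U.1) hc P
  have hq : SheafOfModules.QuasicoherentData.IsFinitePresentation.{u, u, u, u} q :=
    SheafOfModules.QuasicoherentData.IsFinitePresentation.mk.{u, u, u, u} (q := q) (fun i ↦ hP i)
  exact SheafOfModules.IsFinitePresentation.mk.{u, u, u} ⟨q, hq⟩

theorem CohArt.isLocalizing_of {R : CommRingCat.{u}} (M : (Spec R).Modules)
    (hex : ∀ (f : R) (V : (Spec R).Opens) (_ : V = PrimeSpectrum.basicOpen f) (s : Γ(M, V)),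
      ∃ (n : ℕ) (t : Γ(M, ⊤)), M.presheaf.map (homOfLE le_top).op t = f ^ n • s)
    (huniq : ∀ (f : R) (V : (Spec R).Opens) (_ : V = PrimeSpectrum.basicOpen f) (t : Γ(M, ⊤)),
      M.presheaf.map (homOfLE le_top).op t = (0 : Γ(M, V)) →
      ∃ (n : ℕ), f ^ n • t = 0) : IsIso M.fromTildeΓ := by
  rw [isIso_fromTildeΓ_iff_isLocalizing]
  refine fun f ↦ IsLocalizedModule.Away.mk_of_addCommGroup ?_ ?_ ?_
  · exact Scheme.Modules.isUnit_algebraMap_end_of_le_basicOpen f le_rfl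
  · intro x
    obtain ⟨n, t, ht⟩ := hex _ _ rfl x
    use n, t, ht.symm
  · intro x hx
    obtain ⟨n, hn⟩ := huniq _ _ rfl _ hx
    use n, hn

theorem CohArt.smul_fromSpec {X : Scheme.{u}} (N : X.Modules) (U : X.Opens)
    (hU : IsAffineOpen U) (V : (Spec Γ(X, U)).Opens) (W : X.Opens) (hW : hU.fromSpec ''ᵁ V = W) (hWU : W ≤ U)
    (r : Γ(X, U)) (x : Γ(N.restrict hU.fromSpec, V)) :
    (N.presheaf.map (eqToHom hW.symm).op) ((N.restrictAppIso hU.fromSpec V).hom (r • x)) =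
      (X.presheaf.map (homOfLE hWU).op r) •
       (N.presheaf.map (eqToHom hW.symm).op) ((N.restrictAppIso hU.fromSpec V).hom x) := by
  subst hW
  have : (Scheme.ΓSpecIso Γ(X, U)).inv ≫ (Spec Γ(X, U)).presheaf.map V.leTop.op ≫
      (hU.fromSpec.appIso V).inv = X.presheaf.map (homOfLE hWU).op := by
    rw [← Category.assoc, Iso.comp_inv_eq, Scheme.Hom.appIso_hom, Scheme.Hom.naturality_assoc,
      hU.fromSpec_app_self]
    simp [← Functor.map_comp]
    rfl
  have h2 : (hU.fromSpec.appIso V).inv ((Spec Γ(X, U)).presheaf.map V.leTop.op 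
    ((Scheme.ΓSpecIso Γ(X, U)).inv r)) = X.presheaf.map (homOfLE hWU).op r := by
    rw [← this]; rfl
  have h3 : (N.restrictAppIso hU.fromSpec V).hom (r • x) = X.presheaf.map (homOfLE hWU).op r •
    (N.restrictAppIso hU.fromSpec V).hom x := by
    rw [← h2]; rfl
  rw [eqToHom_refl, op_id, N.presheaf.map_id]
  exact h3

noncomputable def CohArt.tr {X : Scheme.{u}} (N : X.Modules) (U : X.Opens)
    (hU : IsAffineOpen U) (V : (Spec Γ(X, U)).Opens) (W : X.Opens) (hW : hU.fromSpec ''ᵁ V = W) :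
    Γ(N.restrict hU.fromSpec, V) ≅ Γ(N, W) :=
  N.restrictAppIso hU.fromSpec V ≪≫ N.presheaf.mapIso (eqToIso hW.symm).op

theorem CohArt.tr_smul {X : Scheme.{u}} (N : X.Modules) (U : X.Opens)
    (hU : IsAffineOpen U) (V : (Spec Γ(X, U)).Opens) (W : X.Opens) (hW : hU.fromSpec ''ᵁ V = W)
    (hWU : W ≤ U) (r : Γ(X, U)) (x : Γ(N.restrict hU.fromSpec, V)) :
    (CohArt.tr N U hU V W hW).hom (r • x) =
      (X.presheaf.map (homOfLE hWU).op r) • (CohArt.tr N U hU V W hW).hom x :=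
  CohArt.smul_fromSpec N U hU V W hW hWU r x

theorem CohArt.tr_map {X : Scheme.{u}} (N : X.Modules) (U : X.Opens)
    (hU : IsAffineOpen U) (V V' : (Spec Γ(X, U)).Opens) (W W' : X.Opens)
    (hW : hU.fromSpec ''ᵁ V = W) (hW' : hU.fromSpec ''ᵁ V' = W') (h : V' ≤ V) (h' : W' ≤ W)
    (x : Γ(N.restrict hU.fromSpec, V)) :
    (CohArt.tr N U hU V' W' hW').hom ((N.restrict hU.fromSpec).presheaf.map (homOfLE h).op x) =
      N.presheaf.map (homOfLE h').op ((CohArt.tr N U hU V W hW).hom x) := by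
  subst hW hW'
  have : (N.restrict hU.fromSpec).presheaf.map (homOfLE h).op ≫ (CohArt.tr N U hU V' _ rfl).hom =
      (CohArt.tr N U hU V _ rfl).hom ≫ N.presheaf.map (homOfLE h').op := by
    simp [CohArt.tr]
  exact congrArg (fun f ↦ f.hom x) this

theorem CohArt.restrict_iso {X : Scheme.{u}} (N : X.Modules) (U : X.Opens) (hU : IsAffineOpen U)
    (hex : ∀ (f : Γ(X, U)) (s : Γ(N, X.basicOpen f)), ∃ (n : ℕ) (t : Γ(N, U)),
      N.presheaf.map (homOfLE (X.basicOpen_le f)).op t =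
        X.presheaf.map (homOfLE (X.basicOpen_le f)).op (f ^ n) • s)
    (huniq : ∀ (f : Γ(X, U)) (t : Γ(N, U)),
      N.presheaf.map (homOfLE (X.basicOpen_le f)).op t = 0 → ∃ (n : ℕ), f ^ n • t = 0)
    (hfin : Module.Finite Γ(X, U) Γ(N, U)) :
    ∃ P : ModuleCat.{u} Γ(X, U), Module.Finite Γ(X, U) P ∧
        Nonempty (N.restrict hU.fromSpec ≅ tilde P) := by
  have htop : hU.fromSpec ''ᵁ ⊤ = U := by simp
  have hb (f : Γ(X, U)) (V : (Spec Γ(X, U)).Opens) (hV : V = PrimeSpectrum.basicOpen f) :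
      hU.fromSpec ''ᵁ V = X.basicOpen f := by
    subst hV; exact hU.fromSpec_image_basicOpen f
  let T := CohArt.tr N U hU ⊤ U htop
  have hT (r : Γ(X, U)) (x) : T.hom (r • x) = r • T.hom x := by
    refine (CohArt.tr_smul N U hU ⊤ U htop le_rfl r x).trans ?_
    congr 1
    exact congrArg (fun f ↦ f.hom r) (X.presheaf.map_id _)
  have inj : Function.Injective T.hom := fun x y h ↦ by
    simpa using congrArg T.inv h
  have iso : IsIso (N.restrict hU.fromSpec).fromTildeΓ := by
    refine CohArt.isLocalizing_of _ ?_ ?_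
    · intro f V hV s
      let S := CohArt.tr N U hU V _ (hb f V hV)
      obtain ⟨n, t, ht⟩ := hex f (S.hom s)
      refine ⟨n, T.inv t, ?_⟩
      have injS : Function.Injective S.hom := fun x y h ↦ by
        simpa using congrArg S.inv h
      apply injS
      refine (CohArt.tr_map N U hU ⊤ V U _ htop (hb f V hV) le_top (X.basicOpen_le f) _).trans ?_
      refine Eq.trans ?_ (CohArt.tr_smul N U hU V _ (hb f V hV) (X.basicOpen_le f) (f ^ n) s).symm
      refine Eq.trans ?_ ht
      congr 1
      exact congrArg (fun f ↦ f.hom t) T.inv_hom_id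
    · intro f V hV t ht
      obtain ⟨n, hn⟩ := huniq f (T.hom t) (by
        refine (CohArt.tr_map N U hU ⊤ V U _ htop (hb f V hV) le_top (X.basicOpen_le f) _).symm.trans ?_
        rw [ht, map_zero])
      refine ⟨n, inj ?_⟩
      rw [hT, hn, map_zero]
  refine ⟨_, ?_, ⟨(asIso (N.restrict hU.fromSpec).fromTildeΓ).symm⟩⟩
  let L : Γ(N, U) →ₗ[Γ(X, U)] Γ(N.restrict hU.fromSpec, ⊤) :=
    { toFun := T.inv
      map_add' := fun x y ↦ map_add _ _ _
      map_smul' := fun r x ↦ inj (by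
        rw [RingHom.id_apply, hT]
        simp) }
  have hL : Function.Surjective L := fun x ↦ ⟨T.hom x, by
    exact congrArg (fun f ↦ f.hom x) T.hom_inv_id⟩
  exact Module.Finite.of_surjective L hL

noncomputable def CohArt.O (X : Scheme.{u}) : X.Modules := SheafOfModules.unit.{u, u, u} X.ringCatSheaf

noncomputable def CohArt.sec {X : Scheme.{u}} {N : X.Modules} (j : N ⟶ CohArt.O X) (U : X.Opens) :
    Γ(N, U) →ₗ[Γ(X, U)] Γ(X, U) where
  toFun := fun x ↦ (j.app U).hom x
  map_add' := fun x y ↦ map_add (j.app U).hom x y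
  map_smul' := fun r x ↦ j.app_smul r x

theorem CohArt.sec_map {X : Scheme.{u}} {N : X.Modules} (j : N ⟶ CohArt.O X) (U V : X.Opens)
    (h : V ≤ U) (x : Γ(N, U)) :
    CohArt.sec j V (N.presheaf.map (homOfLE h).op x) =
      X.presheaf.map (homOfLE h).op (CohArt.sec j U x) :=
  congrArg (fun f ↦ f.hom x) (j.mapPresheaf.naturality (homOfLE h).op)

theorem CohArt.fp_of_mono {X : Scheme.{u}} [IsLocallyNoetherian X] {N : X.Modules}
    (j : N ⟶ CohArt.O X) (I : X.IdealSheafData)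
    (hinj : ∀ U, Function.Injective (CohArt.sec j U))
    (hr : ∀ U : X.affineOpens, LinearMap.range (CohArt.sec j U.1) = I.ideal U) :
    SheafOfModules.IsFinitePresentation.{u, u, u} N := by
  refine CohArt.fp_of_restrict N fun U hU ↦ CohArt.restrict_iso N U hU ?_ ?_ ?_
  · intro f s
    have := hU.isLocalization_basicOpen f
    have h1 : CohArt.sec j (X.basicOpen f) s ∈ I.ideal (X.affineBasicOpen (U := ⟨U, hU⟩) f) := by
      rw [← hr]; exact ⟨s, rfl⟩
    rw [← I.map_ideal_basicOpen] at h1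
    obtain ⟨⟨⟨a, ha⟩, ⟨_, n, rfl⟩⟩, hn⟩ := (IsLocalization.mem_map_algebraMap_iff (.powers f) _).1 h1
    rw [← hr] at ha
    obtain ⟨t, ht⟩ := ha
    refine ⟨n, t, hinj _ ?_⟩
    rw [CohArt.sec_map, map_smul, smul_eq_mul, mul_comm]
    refine Eq.trans ?_ hn.symm
    exact congrArg _ ht
  · intro f t ht
    have := hU.isLocalization_basicOpen f
    have h1 : algebraMap Γ(X, U) Γ(X, X.basicOpen f) (CohArt.sec j U t) = 0 := by
      refine (CohArt.sec_map j U _ (X.basicOpen_le f) t).symm.trans ?_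
      rw [ht, map_zero]
    obtain ⟨⟨_, n, rfl⟩, hn⟩ := (IsLocalization.map_eq_zero_iff (.powers f) _ _).1 h1
    refine ⟨n, hinj _ ?_⟩
    rw [map_smul, map_zero]; exact hn
  · have : IsNoetherianRing Γ(X, U) := IsLocallyNoetherian.component_noetherian ⟨U, hU⟩
    exact Module.Finite.of_injective (CohArt.sec j U) (hinj U)

theorem CohArt.fp_O (X : Scheme.{u}) [IsLocallyNoetherian X] :
    SheafOfModules.IsFinitePresentation.{u, u, u} (CohArt.O X) := by
  refine CohArt.fp_of_mono (𝟙 (CohArt.O X)) ⊤ (fun U x y h ↦ h) (fun U ↦ ?_)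
  rw [Scheme.IdealSheafData.ideal_top]
  exact LinearMap.range_eq_top.2 fun x ↦ ⟨x, rfl⟩

noncomputable def CohArt.phi {X Z : Scheme.{u}} (i : Z ⟶ X) :
    CohArt.O X ⟶ (Scheme.Modules.pushforward i).obj (CohArt.O Z) :=
  SheafOfModules.unitToPushforwardObjUnit _

theorem CohArt.phi_app {X Z : Scheme.{u}} (i : Z ⟶ X) (U : X.Opens) (a : Γ(X, U)) :
    ((CohArt.phi i).app U).hom a = i.app U a := rfl

theorem CohArt.mono_inj {X : Scheme.{u}} {M N : X.Modules} (j : M ⟶ N) [Mono j] (U : X.Opens) :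
    Function.Injective (j.app U) := by
  have : Mono ((Scheme.Modules.toPresheaf X).map j) := inferInstance
  have : Mono (j.app U) :=
    (NatTrans.mono_iff_mono_app _).1 this (.op U)
  exact (AddCommGrpCat.mono_iff_injective _).1 this

theorem CohArt.ker_range {X : Scheme.{u}} {M N : X.Modules} (φ : M ⟶ N) (U : X.Opens)
    (a : Γ(M, U)) (ha : (φ.app U).hom a = 0) : ∃ t, ((kernel.ι φ).app U).hom t = a := by
  let G : X.Modules ⥤ Ab := Scheme.Modules.toPresheaf X ⋙ (evaluation _ _).obj (.op U)
  have hz : G.PreservesZeroMorphisms := ⟨fun _ _ ↦ rfl⟩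
  have hev : PreservesLimitsOfShape WalkingParallelPair
      ((evaluation (TopologicalSpace.Opens X)ᵒᵖ Ab.{u}).obj (.op U)) := inferInstance
  have hG : PreservesLimitsOfShape WalkingParallelPair G :=
    @comp_preservesLimitsOfShape _ _ _ _ _ _ _ _ (Scheme.Modules.toPresheaf X)
      ((evaluation _ _).obj (.op U)) inferInstance hev
  have w : G.map (kernel.ι φ) ≫ G.map φ = 0 := by
    rw [← G.map_comp, kernel.condition, G.map_zero]
  let S := ShortComplex.mk (G.map (kernel.ι φ)) (G.map φ) w
  have hS : S.Exact := S.exact_of_f_is_kernel (isLimitOfHasKernelOfPreservesLimit G φ)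
  exact (ShortComplex.ab_exact_iff S).1 hS a ha

theorem CohArt.ker_sec {X Z : Scheme.{u}} (i : Z ⟶ X) (U : X.Opens) :
    LinearMap.range (CohArt.sec (kernel.ι (CohArt.phi i)) U) = RingHom.ker (i.app U).hom := by
  ext a
  constructor
  · rintro ⟨t, rfl⟩
    have := congrArg (fun f ↦ (Scheme.Modules.Hom.app f U).hom t) (kernel.condition (CohArt.phi i))
    exact this
  · intro ha
    obtain ⟨t, ht⟩ := CohArt.ker_range (CohArt.phi i) U a ha
    exact ⟨t, ht⟩

/-- The ideal sheaf, as a subobject of the structure sheaf. -/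
noncomputable def CohArt.sub {X : Scheme.{u}} (I : X.IdealSheafData) : Subobject (CohArt.O X) :=
  Subobject.mk (kernel.ι (CohArt.phi I.subschemeι))

theorem CohArt.ker_sec_affine {X : Scheme.{u}} (I : X.IdealSheafData) (U : X.affineOpens) :
    LinearMap.range (CohArt.sec (kernel.ι (CohArt.phi I.subschemeι)) U.1) = I.ideal U := by
  rw [CohArt.ker_sec]
  exact I.ker_subschemeι_app U

theorem CohArt.range_le {X : Scheme.{u}} {M N : X.Modules} (j : M ⟶ CohArt.O X)
    (k : N ⟶ CohArt.O X) (l : M ⟶ N) (h : l ≫ k = j) (U : X.Opens) :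
    LinearMap.range (CohArt.sec j U) ≤ LinearMap.range (CohArt.sec k U) := by
  subst h
  rintro _ ⟨t, rfl⟩
  exact ⟨(l.app U).hom t, rfl⟩

theorem CohArt.sub_fp {X : Scheme.{u}} [IsLocallyNoetherian X] (I : X.IdealSheafData) :
    SheafOfModules.IsFinitePresentation.{u, u, u} ((CohArt.sub I : Subobject (CohArt.O X)) : X.Modules) := by
  refine CohArt.fp_of_mono (CohArt.sub I).arrow I
    (fun U ↦ CohArt.mono_inj (CohArt.sub I).arrow U) (fun U ↦ ?_)
  rw [← CohArt.ker_sec_affine]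
  refine le_antisymm ?_ ?_
  · exact CohArt.range_le _ _ (Subobject.underlyingIso _).hom (Subobject.underlyingIso_hom_comp_eq_mk _) _
  · exact CohArt.range_le _ _ (Subobject.underlyingIso _).inv (Subobject.underlyingIso_arrow _) _

theorem CohArt.sub_mono {X : Scheme.{u}} {I J : X.IdealSheafData} (h : I ≤ J) :
    CohArt.sub I ≤ CohArt.sub J := by
  refine Subobject.mk_le_mk_of_comm (kernel.lift _ (kernel.ι _) ?_) (kernel.lift_ι _ _ _)
  refine Scheme.Modules.hom_ext _ _ fun U ↦ ?_
  ext t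
  have h1 : CohArt.sec (kernel.ι (CohArt.phi I.subschemeι)) U t ∈
      RingHom.ker (I.subschemeι.app U).hom := by
    rw [← CohArt.ker_sec]; exact ⟨t, rfl⟩
  have h2 : RingHom.ker (I.subschemeι.app U).hom ≤ RingHom.ker (J.subschemeι.app U).hom := by
    rw [← Scheme.IdealSheafData.inclusion_subschemeι h]
    intro a ha
    rw [RingHom.mem_ker] at ha ⊢
    rw [Scheme.Hom.comp_app]
    refine (congrArg (fun x ↦ ((Scheme.IdealSheafData.inclusion h).app _).hom x) ha).trans ?_
    exact map_zero _
  exact h2 h1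

theorem CohArt.sub_inj {X : Scheme.{u}} {I J : X.IdealSheafData} (h : CohArt.sub I = CohArt.sub J) :
    I = J := by
  ext U : 2
  rw [← CohArt.ker_sec_affine, ← CohArt.ker_sec_affine]
  refine le_antisymm ?_ ?_
  · exact CohArt.range_le _ _ (Subobject.ofMkLEMk _ _ h.le) (Subobject.ofMkLEMk_comp _) _
  · exact CohArt.range_le _ _ (Subobject.ofMkLEMk _ _ h.ge) (Subobject.ofMkLEMk_comp _) _

/-- Let `X` be a Noetherian scheme whose category of coherent sheaves is
Artinian, i.e. every descending chain of coherent subsheaves of a coherent sheaf stabilizes.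
Then `X` is an affine Artinian scheme: `X` is affine and its ring of global sections is an
Artinian ring. -/
theorem affine_artinian_of_coh_artinian
    (X : Scheme) [AlgebraicGeometry.IsNoetherian X]
    (hArt : ∀ (M : X.Modules), Scheme.Modules.IsCoherent M →
      ∀ f : ℕ → Subobject M,
        (∀ n, Scheme.Modules.IsCoherent ((f n : X.Modules))) → Antitone f →
          ∃ n, ∀ m ≥ n, f m = f n) :
    IsAffine X ∧ IsArtinianRing Γ(X, ⊤) := by
  have coh {N : X.Modules} (h : SheafOfModules.IsFinitePresentation.{0, 0, 0} N) :
      Scheme.Modules.IsCoherent N := by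
    have := h
    exact ⟨SheafOfModules.instIsQuasicoherentOfIsFinitePresentation N, SheafOfModules.instIsFiniteTypeOfIsFinitePresentation N⟩
  refine CohArt.final X fun I ↦ ?_
  obtain ⟨n, hn⟩ := hArt (CohArt.O X) (coh (CohArt.fp_O X)) (fun n ↦ CohArt.sub (I ^ n))
    (fun n ↦ coh (CohArt.sub_fp (I ^ n)))
    (fun m n h ↦ CohArt.sub_mono (fun U ↦ Ideal.pow_le_pow_right h))
  exact ⟨n, (CohArt.sub_inj (hn (n + 1) (Nat.le_succ n))).symm⟩
end

section
/- Let f : Y → X be a proper morphism of Noetherian schemes such that every fiber of f over a point of X is a finite discrete scheme (i.e., f is quasi-finite). Then f is a finite morphism. -/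
open CategoryTheory AlgebraicGeometry

/-- A proper morphism of Noetherian schemes with finite (discrete) fibers,
i.e. a proper quasi-finite morphism, is finite. -/
theorem isFinite_of_isProper_of_finite_fibers
    {Y X : AlgebraicGeometry.Scheme} (f : Y ⟶ X)
    [AlgebraicGeometry.IsNoetherian Y] [AlgebraicGeometry.IsNoetherian X]
    [AlgebraicGeometry.IsProper f]
    (hfin : ∀ x : X, Set.Finite (f.base ⁻¹' {x})) :
    AlgebraicGeometry.IsFinite f := by
  have : LocallyQuasiFinite f := LocallyQuasiFinite.of_finite_preimage_singleton f hfin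
  exact IsFinite.of_isProper_of_locallyQuasiFinite f
end
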